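/- arXiv:2310.04224 — 2 statements merged into one kernel-verified Lean document; each statement's English description precedes it below -/
import Mathlib

section
/- Let G be a countably infinite discrete amenable group and let φ be a real-valued function on the collection of nonempty finite subsets of G which is non-negative (φ(F) ≥ 0), monotone (φ(E) ≤ φ(F) whenever E ⊆ F), right-invariant (φ(Fg) = φ(F) for all finite F and g ∈ G), and sub-additive on disjoint unions (φ(E ∪ F) ≤ φ(E) + φ(F) whenever E ∩ F = ∅). Then there exists a real number λ ≥ 0 such that φ(F_n)/|F_n| → λ for every Følner sequence {F_n} of G; in particular, the limit exists and is independent of the choice of Følner sequence. -/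
open Filter

/-- `B(F,K) = {g ∈ G : Kg ∩ F ≠ ∅ and Kg ∩ (G∖F) ≠ ∅}`. -/
def folnerB {G : Type} [Group G] (F K : Finset G) : Set G :=
  {g : G | (∃ k ∈ K, k * g ∈ F) ∧ ∃ k ∈ K, k * g ∉ F}

/-- A Følner sequence of `G`: a sequence of nonempty finite subsets `F n` such that for every
nonempty finite `K ⊆ G`, `|B(F n, K)| / |F n| → 0`. -/
def IsFolner {G : Type} [Group G] (F : ℕ → Finset G) : Prop :=
  (∀ n, (F n).Nonempty) ∧
    ∀ K : Finset G, K.Nonempty →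
      Tendsto (fun n => ((folnerB (F n) K).ncard : ℝ) / ((F n).card : ℝ)) atTop (nhds 0)

section Boundary

variable {G : Type} [Group G]

theorem folnerB_finite (F K : Finset G) : (folnerB F K).Finite := by
  classical
  refine ((K ×ˢ F).image fun p => p.1⁻¹ * p.2).finite_toSet.subset ?_
  rintro g ⟨⟨k, hk, hkg⟩, -⟩
  simp only [Finset.coe_image, Set.mem_image, Finset.mem_coe, Finset.mem_product]
  exact ⟨(k, k * g), ⟨hk, hkg⟩, by simp⟩

theorem ncard_folnerB_mono (F : Finset G) {K K' : Finset G} (h : K ⊆ K') :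
    (folnerB F K).ncard ≤ (folnerB F K').ncard := by
  refine Set.ncard_le_ncard ?_ (folnerB_finite F K')
  rintro g ⟨⟨k, hk, hkg⟩, ⟨l, hl, hlg⟩⟩
  exact ⟨⟨k, h hk, hkg⟩, ⟨l, h hl, hlg⟩⟩

variable [DecidableEq G]

theorem ncard_folnerB_union_le (E F K : Finset G) :
    (folnerB (E ∪ F) K).ncard ≤ (folnerB E K).ncard + (folnerB F K).ncard := by
  refine (Set.ncard_le_ncard ?_ ((folnerB_finite E K).union (folnerB_finite F K))).trans
    (Set.ncard_union_le _ _)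
  rintro g ⟨⟨k, hk, hkg⟩, ⟨l, hl, hlg⟩⟩
  simp only [Finset.mem_union, not_or] at hkg hlg
  rcases hkg with h | h
  · exact Or.inl ⟨⟨k, hk, h⟩, ⟨l, hl, hlg.1⟩⟩
  · exact Or.inr ⟨⟨k, hk, h⟩, ⟨l, hl, hlg.2⟩⟩

theorem ncard_folnerB_sdiff_le (F T K : Finset G) :
    (folnerB (F \ T) K).ncard ≤ (folnerB F K).ncard + (folnerB T K).ncard := by
  refine (Set.ncard_le_ncard ?_ ((folnerB_finite F K).union (folnerB_finite T K))).trans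
    (Set.ncard_union_le _ _)
  rintro g ⟨⟨k, hk, hkg⟩, ⟨l, hl, hlg⟩⟩
  simp only [Finset.mem_sdiff, not_and, not_not] at hkg hlg
  by_cases h : l * g ∈ F
  · exact Or.inr ⟨⟨l, hl, hlg h⟩, ⟨k, hk, hkg.2⟩⟩
  · exact Or.inl ⟨⟨k, hk, hkg.1⟩, ⟨l, hl, h⟩⟩

theorem ncard_folnerB_image_mul_right_le (F K : Finset G) (c : G) :
    (folnerB (F.image (· * c)) K).ncard ≤ (folnerB F K).ncard := by
  refine (Set.ncard_le_ncard (t := (· * c) '' folnerB F K) ?_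
    ((folnerB_finite F K).image _)).trans (Set.ncard_image_le (folnerB_finite F K))
  rintro g ⟨⟨k, hk, hkg⟩, ⟨l, hl, hlg⟩⟩
  have key : ∀ x, x * g ∈ F.image (· * c) ↔ x * (g * c⁻¹) ∈ F := by
    intro x
    simp only [Finset.mem_image]
    constructor
    · rintro ⟨y, hy, hyx⟩
      rwa [← mul_assoc, ← hyx, mul_inv_cancel_right]
    · intro h
      exact ⟨_, h, by group⟩
  rw [key] at hkg hlg
  exact ⟨g * c⁻¹, ⟨⟨k, hk, hkg⟩, ⟨l, hl, hlg⟩⟩, by simp⟩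

theorem ncard_folnerB_biUnion_le (C K K' : Finset G) :
    (folnerB (C.biUnion fun c => K.image (· * c)) K').ncard
      ≤ C.card * (folnerB K K').ncard := by
  induction C using Finset.induction_on with
  | empty => simp [folnerB]
  | insert c C hc ih =>
    rw [Finset.biUnion_insert, Finset.card_insert_of_notMem hc]
    have h1 := ncard_folnerB_union_le (K.image (· * c)) (C.biUnion fun c => K.image (· * c)) K'
    have h2 := ncard_folnerB_image_mul_right_le K K' c
    linarith

/-- At most `|B(R, K)|` elements of `R` fail to produce a right translate of `K` inside `R`. -/
theorem card_le_card_add_ncard_folnerB {R K D : Finset G} (hK : K.Nonempty)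
    (hD : ∀ c, K.image (· * c) ⊆ R → c ∈ D) :
    R.card ≤ D.card + (folnerB R K).ncard := by
  obtain ⟨k, hk⟩ := hK
  have hsub : ((R.image (k⁻¹ * ·) : Finset G) : Set G) ⊆ (D : Set G) ∪ folnerB R K := by
    intro g hg
    simp only [Finset.coe_image, Set.mem_image, Finset.mem_coe] at hg
    obtain ⟨r, hr, rfl⟩ := hg
    by_cases h : K.image (· * (k⁻¹ * r)) ⊆ R
    · exact Or.inl (hD _ h)
    · obtain ⟨x, hx, hxR⟩ := Finset.not_subset.1 h
      obtain ⟨l, hl, rfl⟩ := Finset.mem_image.1 hx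
      exact Or.inr ⟨⟨k, hk, by simpa using hr⟩, ⟨l, hl, hxR⟩⟩
  have h1 := (Set.ncard_le_ncard hsub (D.finite_toSet.union (folnerB_finite R K))).trans
    (Set.ncard_union_le _ _)
  rwa [Set.ncard_coe_finset, Set.ncard_coe_finset,
    Finset.card_image_of_injective _ (mul_right_injective _)] at h1

theorem sum_card_image_mul_right_inter_le (D K S : Finset G) :
    ∑ c ∈ D, (K.image (· * c) ∩ S).card ≤ K.card * S.card := by
  have h : ∀ c ∈ D, (K.image (· * c) ∩ S).card ≤ ∑ k ∈ K, if k * c ∈ S then 1 else 0 := by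
    intro c _
    rw [← Finset.card_filter]
    refine (Finset.card_le_card ?_).trans (Finset.card_image_le (f := (· * c)))
    intro x hx
    obtain ⟨hx, hxS⟩ := Finset.mem_inter.1 hx
    obtain ⟨k, hk, rfl⟩ := Finset.mem_image.1 hx
    exact Finset.mem_image_of_mem _ (Finset.mem_filter.2 ⟨hk, hxS⟩)
  refine (Finset.sum_le_sum h).trans ?_
  rw [Finset.sum_comm, ← smul_eq_mul]
  refine Finset.sum_le_card_nsmul _ _ _ fun k _ => ?_
  rw [← Finset.card_filter]
  refine Finset.card_le_card_of_injOn (k * ·) (fun c hc => ?_) (mul_right_injective k).injOn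
  exact (Finset.mem_filter.1 hc).2

/-- A maximal `ε`-disjoint family of right translates of `K` inside `R` covers at least the
proportion `ε` of the points of `R` outside the `K`-boundary. -/
theorem exists_almost_disjoint_translates (R : Finset G) {K : Finset G} (hK : K.Nonempty)
    {ε : ℝ} (hε0 : 0 ≤ ε) (hε1 : ε ≤ 1) :
    ∃ C : Finset G, (C.biUnion fun c => K.image (· * c)) ⊆ R ∧
      (1 - ε) * (C.card * K.card) ≤ ((C.biUnion fun c => K.image (· * c)).card : ℝ) ∧
      ε * (R.card - (folnerB R K).ncard) ≤ ((C.biUnion fun c => K.image (· * c)).card : ℝ) := by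
  have hKpos : (0 : ℝ) < K.card := by exact_mod_cast hK.card_pos
  have hcard : ∀ c, (K.image (· * c)).card = K.card := fun c =>
    Finset.card_image_of_injective _ (mul_left_injective c)
  obtain ⟨D, hD⟩ : ∃ D : Finset G, ∀ c, c ∈ D ↔ K.image (· * c) ⊆ R := by
    obtain ⟨k, hk⟩ := hK
    refine ⟨(R.image (k⁻¹ * ·)).filter fun c => K.image (· * c) ⊆ R, fun c => ?_⟩
    rw [Finset.mem_filter, and_iff_right_iff_imp]
    intro h
    exact Finset.mem_image.2 ⟨k * c, h (Finset.mem_image_of_mem _ hk), by simp⟩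
  obtain ⟨C, hC, hmax⟩ := Finset.exists_max_image
    (D.powerset.filter fun C : Finset G => (1 - ε) * (C.card * K.card) ≤
      ((C.biUnion fun c => K.image (· * c)).card : ℝ)) Finset.card ⟨∅, by simp⟩
  rw [Finset.mem_filter, Finset.mem_powerset] at hC
  obtain ⟨hCD, hCε⟩ := hC
  refine ⟨C, Finset.biUnion_subset.2 fun c hc => (hD c).1 (hCD hc), hCε, ?_⟩
  set S := C.biUnion fun c => K.image (· * c) with hS
  have hmeet : ∀ c ∈ D, ε * K.card ≤ ((K.image (· * c) ∩ S).card : ℝ) := by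
    intro c hc
    by_cases hcC : c ∈ C
    · rw [Finset.inter_eq_left.2 (Finset.subset_biUnion_of_mem (fun c => K.image (· * c)) hcC),
        hcard]
      nlinarith
    · by_contra! hlt
      have hins : insert c C ∈ D.powerset.filter fun C : Finset G =>
          (1 - ε) * (C.card * K.card) ≤ ((C.biUnion fun c => K.image (· * c)).card : ℝ) := by
        rw [Finset.mem_filter, Finset.mem_powerset]
        refine ⟨Finset.insert_subset hc hCD, ?_⟩
        have h := Finset.card_union_add_card_inter (K.image (· * c)) S
        rw [hcard] at h
        have h' : (((K.image (· * c) ∪ S).card : ℝ)) + (K.image (· * c) ∩ S).card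
            = K.card + S.card := by exact_mod_cast h
        rw [Finset.biUnion_insert, Finset.card_insert_of_notMem hcC, ← hS]
        push_cast
        linarith
      have := hmax _ hins
      rw [Finset.card_insert_of_notMem hcC] at this
      omega
  have h1 : D.card * (ε * K.card) ≤ K.card * (S.card : ℝ) := by
    calc D.card * (ε * K.card) = ∑ c ∈ D, ε * (K.card : ℝ) := by simp
      _ ≤ ∑ c ∈ D, ((K.image (· * c) ∩ S).card : ℝ) := Finset.sum_le_sum hmeet
      _ ≤ K.card * (S.card : ℝ) := by exact_mod_cast sum_card_image_mul_right_inter_le D K S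
  have h2 : ε * D.card ≤ S.card := by
    refine le_of_mul_le_mul_left ?_ hKpos
    linarith
  have h3 : (R.card : ℝ) ≤ D.card + (folnerB R K).ncard := by
    exact_mod_cast card_le_card_add_ncard_folnerB hK fun c hc => (hD c).2 hc
  nlinarith

end Boundary

theorem le_sum_of_union_le {α : Type*} [DecidableEq α] {ψ : Finset α → ℝ} (h0 : ψ ∅ = 0)
    (hunion : ∀ E F, ψ (E ∪ F) ≤ ψ E + ψ F) {ι : Type*} [DecidableEq ι]
    (C : Finset ι) (t : ι → Finset α) :
    ψ (C.biUnion t) ≤ ∑ c ∈ C, ψ (t c) := by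
  induction C using Finset.induction_on with
  | empty => simp [h0]
  | insert c C hc ih =>
    rw [Finset.biUnion_insert, Finset.sum_insert hc]
    linarith [hunion (t c) (C.biUnion t)]

section InvarianceFilter

variable {G : Type} [Group G]

/-- The filter on finite subsets of `G` generated by the sets of nonempty `F` with
`|B(F, K)| / |F|` small, `K` ranging over the nonempty finite subsets of `G`. -/
noncomputable def invarianceFilter (G : Type) [Group G] : Filter (Finset G) :=
  (⨅ K : Finset G, ⨅ _ : K.Nonempty,
    comap (fun F => ((folnerB F K).ncard : ℝ) / (F.card : ℝ)) (nhds 0)) ⊓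
      𝓟 {F | F.Nonempty}

theorem IsFolner.tendsto_invarianceFilter {Fseq : ℕ → Finset G} (h : IsFolner Fseq) :
    Tendsto Fseq atTop (invarianceFilter G) := by
  rw [invarianceFilter, tendsto_inf]
  simp only [tendsto_iInf, tendsto_comap_iff]
  exact ⟨h.2, tendsto_principal.2 (Eventually.of_forall h.1)⟩

theorem eventually_nonempty_invarianceFilter :
    ∀ᶠ F in invarianceFilter G, F.Nonempty :=
  mem_inf_of_right (mem_principal_self _)

theorem eventually_ncard_folnerB_le {K : Finset G} (hK : K.Nonempty) {η : ℝ} (hη : 0 < η) :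
    ∀ᶠ F in invarianceFilter G, ((folnerB F K).ncard : ℝ) ≤ η * F.card := by
  have ht : Tendsto (fun F : Finset G => ((folnerB F K).ncard : ℝ) / (F.card : ℝ))
      (invarianceFilter G) (nhds 0) :=
    tendsto_comap.mono_left (inf_le_left.trans (iInf₂_le K hK))
  filter_upwards [ht.eventually (Iio_mem_nhds hη), eventually_nonempty_invarianceFilter]
    with F hF hne
  have : (0 : ℝ) < F.card := by exact_mod_cast hne.card_pos
  exact ((div_lt_iff₀ this).1 hF).le

variable [DecidableEq G] {ψ : Finset G → ℝ}

/-- Quasi-tiling: if sets `K` with `ψ K ≤ L |K|` occur frequently along the invariance filter,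
then eventually every `F` contains an invariant set `T` with `(1 - ε) ψ T ≤ L |T|` that covers
all but a proportion about `(1 - ε) ^ N` of `F`. -/
theorem eventually_exists_quasitiling (h0 : ψ ∅ = 0) (hunion : ∀ E F, ψ (E ∪ F) ≤ ψ E + ψ F)
    (hinv : ∀ F g, ψ (F.image (· * g)) = ψ F) {L ε : ℝ} (hL : 0 ≤ L) (hε0 : 0 ≤ ε)
    (hε : ε ≤ 1 / 2) (hfreq : ∃ᶠ K in invarianceFilter G, ψ K ≤ L * K.card) (N : ℕ) :
    ∀ K' : Finset G, K'.Nonempty → ∀ η : ℝ, 0 < η → ∀ᶠ F in invarianceFilter G,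
      ∃ T ⊆ F, (1 - ε) * ψ T ≤ L * T.card ∧
        (F.card : ℝ) - T.card ≤ ((1 - ε) ^ N + η) * F.card ∧
        ((folnerB T K').ncard : ℝ) ≤ η * F.card := by
  induction N with
  | zero =>
    intro K' _ η hη
    refine Eventually.of_forall fun F => ⟨∅, by simp, by simp [h0], ?_, ?_⟩
    · have : (0 : ℝ) ≤ F.card := by positivity
      simp only [Finset.card_empty, pow_zero, Nat.cast_zero]
      nlinarith
    · simp only [folnerB, Finset.notMem_empty, and_false, exists_false, false_and,
        Set.ofPred_false, Set.ncard_empty, Nat.cast_zero]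
      positivity
  | succ N ih =>
    intro K' hK' η hη
    have hη3 : 0 < η / 3 := by positivity
    obtain ⟨K, hψK, hKK', hK⟩ := (hfreq.and_eventually ((eventually_ncard_folnerB_le hK' hη3).and
      eventually_nonempty_invarianceFilter)).exists
    filter_upwards [ih (K' ∪ K) (hK'.mono Finset.subset_union_left) _ hη3,
      eventually_ncard_folnerB_le hK hη3] with F ⟨T, hTF, hψT, hcov, hTB⟩ hFB
    obtain ⟨C, hCR, hCdisj, hCcov⟩ :=
      exists_almost_disjoint_translates (F \ T) hK hε0 (by linarith)
    have hSB := ncard_folnerB_biUnion_le C K K'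
    have hψS := le_sum_of_union_le h0 hunion C fun c => K.image (· * c)
    simp only [hinv, Finset.sum_const, nsmul_eq_mul] at hψS
    set S := C.biUnion fun c => K.image (· * c)
    have hdisj : Disjoint T S := Finset.disjoint_sdiff.mono_right hCR
    have hSF : S ⊆ F := hCR.trans Finset.sdiff_subset
    have hScard : (S.card : ℝ) ≤ F.card := by exact_mod_cast Finset.card_le_card hSF
    have hcard : ((T ∪ S).card : ℝ) = T.card + S.card := by
      exact_mod_cast Finset.card_union_of_disjoint hdisj
    have hRcard : ((F \ T).card : ℝ) = F.card - T.card := by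
      rw [Finset.card_sdiff_of_subset hTF, Nat.cast_sub (Finset.card_le_card hTF)]
    have hTK : ((folnerB T K).ncard : ℝ) ≤ η / 3 * F.card := le_trans
      (by exact_mod_cast ncard_folnerB_mono T Finset.subset_union_right) hTB
    have hTK' : ((folnerB T K').ncard : ℝ) ≤ η / 3 * F.card := le_trans
      (by exact_mod_cast ncard_folnerB_mono T Finset.subset_union_left) hTB
    refine ⟨T ∪ S, Finset.union_subset hTF hSF, ?_, ?_, ?_⟩
    · have h1 : (C.card : ℝ) * ψ K ≤ C.card * (L * K.card) := by gcongr
      have h2 : (1 - ε) * ψ (T ∪ S) ≤ (1 - ε) * (ψ T + C.card * (L * K.card)) :=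
        mul_le_mul_of_nonneg_left (by linarith [hunion T S]) (by linarith)
      have h3 := mul_le_mul_of_nonneg_left hCdisj hL
      rw [hcard]
      linarith
    · have h1 : ((folnerB (F \ T) K).ncard : ℝ)
          ≤ (folnerB F K).ncard + (folnerB T K).ncard := by
        exact_mod_cast ncard_folnerB_sdiff_le F T K
      have h2 : ε * ((folnerB (F \ T) K).ncard : ℝ) ≤ 1 * (2 * (η / 3) * F.card) :=
        mul_le_mul (by linarith) (by linarith) (by positivity) (by norm_num)
      have h3 : (1 - ε) * ((F.card : ℝ) - T.card)
          ≤ (1 - ε) * (((1 - ε) ^ N + η / 3) * F.card) :=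
        mul_le_mul_of_nonneg_left hcov (by linarith)
      have h4 : 0 ≤ ε * (η / 3 * F.card) := by positivity
      rw [hRcard] at hCcov
      rw [hcard, pow_succ]
      linarith
    · have h1 : ((folnerB (T ∪ S) K').ncard : ℝ)
          ≤ (folnerB T K').ncard + (folnerB S K').ncard := by
        exact_mod_cast ncard_folnerB_union_le T S K'
      have h2 : ((folnerB S K').ncard : ℝ) ≤ C.card * (folnerB K K').ncard := by
        exact_mod_cast hSB
      have h3 : (C.card : ℝ) * (folnerB K K').ncard ≤ C.card * (η / 3 * K.card) := by gcongr
      have h4 : 1 / 2 * ((C.card : ℝ) * K.card) ≤ (1 - ε) * (C.card * K.card) :=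
        mul_le_mul_of_nonneg_right (by linarith) (by positivity)
      have h5 : (C.card : ℝ) * K.card ≤ 2 * F.card := by linarith
      have h6 := mul_le_mul_of_nonneg_left h5 hη3.le
      linarith

theorem le_mul_card_of_union_le (h0 : ψ ∅ = 0) (hunion : ∀ E F, ψ (E ∪ F) ≤ ψ E + ψ F)
    (hinv : ∀ F g, ψ (F.image (· * g)) = ψ F) (F : Finset G) : ψ F ≤ ψ {1} * F.card := by
  have h := le_sum_of_union_le h0 hunion F fun g => ({1} : Finset G).image (· * g)
  simp only [hinv, Finset.sum_const, nsmul_eq_mul] at h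
  simp only [Finset.image_singleton, one_mul, Finset.biUnion_singleton_eq_self] at h
  linarith

theorem eventually_div_card_lt (h0 : ψ ∅ = 0) (hnonneg : ∀ F, 0 ≤ ψ F)
    (hunion : ∀ E F, ψ (E ∪ F) ≤ ψ E + ψ F)
    (hinv : ∀ F g, ψ (F.image (· * g)) = ψ F) {L a : ℝ} (hL : 0 ≤ L) (hLa : L < a)
    (hfreq : ∃ᶠ K in invarianceFilter G, ψ K ≤ L * K.card) :
    ∀ᶠ F in invarianceFilter G, ψ F / F.card < a := by
  set M := ψ {1}
  have hM : 0 ≤ M := hnonneg _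
  obtain ⟨ε, hε0, hε, hεL⟩ : ∃ ε : ℝ, 0 < ε ∧ ε ≤ 1 / 2 ∧ L ≤ (1 - ε) * ((L + a) / 2) := by
    have ha : 0 < a := hL.trans_lt hLa
    refine ⟨(a - L) / (2 * a), div_pos (by linarith) (by linarith), ?_, ?_⟩
    · rw [div_le_div_iff₀ (by linarith) (by norm_num)]
      linarith
    · have : (1 - (a - L) / (2 * a)) * ((L + a) / 2) = L + (a - L) ^ 2 / (4 * a) := by
        field_simp
        ring
      rw [this]
      have : 0 ≤ (a - L) ^ 2 / (4 * a) := by positivity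
      linarith
  obtain ⟨η, hη, hηM⟩ : ∃ η : ℝ, 0 < η ∧ M * (2 * η) < (a - L) / 2 := by
    refine ⟨(a - L) / (4 * (M + 1)), div_pos (by linarith) (by linarith), ?_⟩
    rw [show M * (2 * ((a - L) / (4 * (M + 1)))) = M * ((a - L) / 2) / (M + 1) by
      field_simp; ring, div_lt_iff₀ (by linarith)]
    nlinarith
  obtain ⟨N, hN⟩ := exists_pow_lt_of_lt_one hη (show 1 - ε < 1 by linarith)
  filter_upwards [eventually_exists_quasitiling h0 hunion hinv hL hε0.le hε hfreq N {1}
    (by simp) η hη, eventually_nonempty_invarianceFilter] with F ⟨T, hTF, hψT, hcov, _⟩ hne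
  have hF : (0 : ℝ) < F.card := by exact_mod_cast hne.card_pos
  have hTcard : (T.card : ℝ) ≤ F.card := by exact_mod_cast Finset.card_le_card hTF
  have hRcard : ((F \ T).card : ℝ) = F.card - T.card := by
    rw [Finset.card_sdiff_of_subset hTF, Nat.cast_sub (Finset.card_le_card hTF)]
  have h1 : ψ F ≤ ψ T + ψ (F \ T) := by
    simpa [Finset.union_sdiff_of_subset hTF] using hunion T (F \ T)
  have h2 : ψ T ≤ (L + a) / 2 * F.card := by
    have h : (1 - ε) * ψ T ≤ (1 - ε) * ((L + a) / 2 * F.card) := by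
      calc (1 - ε) * ψ T ≤ L * T.card := hψT
        _ ≤ L * F.card := by gcongr
        _ ≤ ((1 - ε) * ((L + a) / 2)) * F.card := by gcongr
        _ = _ := by ring
    exact le_of_mul_le_mul_left h (by linarith)
  have h3 : ψ (F \ T) ≤ M * (2 * η) * F.card := by
    calc ψ (F \ T) ≤ M * (F \ T).card := le_mul_card_of_union_le h0 hunion hinv _
      _ ≤ M * (2 * η * F.card) := by
        rw [hRcard]
        refine mul_le_mul_of_nonneg_left (hcov.trans ?_) hM
        gcongr
        linarith
      _ = _ := by ring
  rw [div_lt_iff₀ hF]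
  have h4 := mul_lt_mul_of_pos_right hηM hF
  linarith

theorem exists_tendsto_div_card_invarianceFilter [(invarianceFilter G).NeBot] (h0 : ψ ∅ = 0)
    (hnonneg : ∀ F, 0 ≤ ψ F) (hunion : ∀ E F, ψ (E ∪ F) ≤ ψ E + ψ F)
    (hinv : ∀ F g, ψ (F.image (· * g)) = ψ F) :
    ∃ l : ℝ, 0 ≤ l ∧ Tendsto (fun F => ψ F / F.card) (invarianceFilter G) (nhds l) := by
  have hpos : ∀ F : Finset G, 0 ≤ ψ F / F.card := fun F => div_nonneg (hnonneg F) (by positivity)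
  have hle : ∀ F : Finset G, ψ F / F.card ≤ ψ {1} := fun F =>
    div_le_of_le_mul₀ (by positivity) (hnonneg _) (le_mul_card_of_union_le h0 hunion hinv F)
  have hbdd : (invarianceFilter G).IsBoundedUnder (· ≥ ·) (fun F => ψ F / F.card) :=
    isBoundedUnder_of ⟨0, hpos⟩
  have hcobdd : (invarianceFilter G).IsCoboundedUnder (· ≥ ·) (fun F => ψ F / F.card) :=
    (isBoundedUnder_of ⟨ψ {1}, hle⟩ :
      (invarianceFilter G).IsBoundedUnder (· ≤ ·) _).isCoboundedUnder_flip
  have hlim : 0 ≤ liminf (fun F => ψ F / F.card) (invarianceFilter G) :=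
    le_liminf_of_le hcobdd (Eventually.of_forall hpos)
  refine ⟨_, hlim, tendsto_order.2 ⟨fun a ha => eventually_lt_of_lt_liminf ha hbdd,
    fun a ha => ?_⟩⟩
  obtain ⟨L, hL, hLa⟩ := exists_between ha
  refine eventually_div_card_lt h0 hnonneg hunion hinv (hlim.trans hL.le) hLa ?_
  refine ((frequently_lt_of_liminf_lt hcobdd hL).and_eventually
    eventually_nonempty_invarianceFilter).mono fun K hK => ?_
  have : (0 : ℝ) < K.card := by exact_mod_cast hK.2.card_pos
  exact ((div_lt_iff₀ this).1 hK.1).le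

end InvarianceFilter

/-- **Ornstein–Weiss lemma.** Let `G` be a countably infinite discrete amenable group and
`φ` a non-negative, monotone, right-invariant function on nonempty finite subsets of `G`
which is sub-additive on disjoint unions.  Then there is `λ ≥ 0` such that
`φ(F_n)/|F_n| → λ` for every Følner sequence `{F_n}` of `G`; in particular the limit exists
and is independent of the choice of Følner sequence. -/
theorem ornstein_weiss_lemma {G : Type} [Group G] [Countable G] [Infinite G] [DecidableEq G]
    (hG : ∃ Fseq : ℕ → Finset G, IsFolner Fseq)
    (φ : Finset G → ℝ)
    (hnonneg : ∀ F : Finset G, F.Nonempty → 0 ≤ φ F)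
    (hmono : ∀ E F : Finset G, E.Nonempty → E ⊆ F → φ E ≤ φ F)
    (hinv : ∀ (F : Finset G) (g : G), F.Nonempty →
      φ (F.image (fun x => x * g)) = φ F)
    (hsub : ∀ E F : Finset G, E.Nonempty → F.Nonempty → Disjoint E F →
      φ (E ∪ F) ≤ φ E + φ F) :
    ∃ lam : ℝ, 0 ≤ lam ∧ ∀ Fseq : ℕ → Finset G, IsFolner Fseq →
      Tendsto (fun n => φ (Fseq n) / ((Fseq n).card : ℝ)) atTop (nhds lam) := by
  obtain ⟨F₀, hF₀⟩ := hG
  have : (invarianceFilter G).NeBot := hF₀.tendsto_invarianceFilter.neBot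
  set ψ : Finset G → ℝ := fun F => if F.Nonempty then φ F else 0 with hψ
  have hψφ : ∀ F : Finset G, F.Nonempty → ψ F = φ F := fun F hF => if_pos hF
  have h0 : ψ ∅ = 0 := by simp [hψ]
  have hψ0 : ∀ F, 0 ≤ ψ F := fun F => by
    by_cases hF : F.Nonempty
    · rw [hψφ F hF]
      exact hnonneg F hF
    · rw [Finset.not_nonempty_iff_eq_empty.1 hF, h0]
  have hunion : ∀ E F, ψ (E ∪ F) ≤ ψ E + ψ F := by
    intro E F
    rcases E.eq_empty_or_nonempty with rfl | hE
    · simp [h0]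
    rcases (F \ E).eq_empty_or_nonempty with h | hFE
    · rw [Finset.union_eq_left.2 (Finset.sdiff_eq_empty_iff_subset.1 h)]
      linarith [hψ0 F]
    · have hF : F.Nonempty := hFE.mono Finset.sdiff_subset
      rw [hψφ E hE, hψφ F hF, hψφ _ (hE.mono Finset.subset_union_left),
        ← Finset.union_sdiff_self_eq_union]
      linarith [hsub E (F \ E) hE hFE Finset.disjoint_sdiff, hmono _ F hFE Finset.sdiff_subset]
  have hψinv : ∀ F g, ψ (F.image (· * g)) = ψ F := by
    intro F g
    rcases F.eq_empty_or_nonempty with rfl | hF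
    · simp
    · rw [hψφ F hF, hψφ _ (hF.image _), hinv F g hF]
  obtain ⟨l, hl, ht⟩ := exists_tendsto_div_card_invarianceFilter h0 hψ0 hunion hψinv
  refine ⟨l, hl, fun Fseq hF => (ht.comp hF.tendsto_invarianceFilter).congr fun n => ?_⟩
  simp only [Function.comp_apply, hψφ _ (hF.1 n)]
end

section
/- Chain-of-covers characterization: for every f ∈ C(X_1), every nonempty finite F ⊆ G and every ε > 0, P^a_r(X_r,f,F,ε) equals the infimum of 𝒫^a(f,F,ε,(𝒰^{(i)})_i) over all chains of open (F,ε)-covers (𝒰^{(i)})_i of (X_i)_i, where 𝒫^a(f,F,ε,(𝒰^{(i)})_i) = Σ_{U^{(r)}∈𝒰^{(r)}} ( Σ_{U^{(r−1)}∈𝒰^{(r−1)}(U^{(r)})} ( ⋯ ( Σ_{U^{(1)}∈𝒰^{(1)}(U^{(2)})} e^{sup_{U^{(1)}} S_F f} )^{a_1} ⋯ )^{a_{r−2}} )^{a_{r−1}}. -/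
open scoped BigOperators NNReal
open Filter

namespace WPP

variable (G : Type) [Group G]

/-- `B(F,K) = {g ∈ G : Kg ∩ F ≠ ∅ and Kg ∩ (G∖F) ≠ ∅}`. -/
def folnerB (F K : Finset G) : Set G :=
  {g : G | (∃ k ∈ K, k * g ∈ F) ∧ ∃ k ∈ K, k * g ∉ F}

/-- A Følner sequence of `G`. -/
def IsFolner (F : ℕ → Finset G) : Prop :=
  (∀ n, (F n).Nonempty) ∧
    ∀ K : Finset G, K.Nonempty →
      Tendsto (fun n => ((folnerB G (F n) K).ncard : ℝ) / ((F n).card : ℝ)) atTop (nhds 0)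

/-- A `G`-system: a compact metric space together with a continuous action of `G`
by homeomorphisms. -/
structure GSystem where
  carrier : Type
  [metric : MetricSpace carrier]
  [cpt : CompactSpace carrier]
  act : G → carrier → carrier
  one_act : ∀ x, act 1 x = x
  mul_act : ∀ g h x, act (g * h) x = act g (act h x)
  cont_act : ∀ g, Continuous (act g)

attribute [instance] GSystem.metric GSystem.cpt

variable {G}

noncomputable instance (S : GSystem G) : MeasurableSpace S.carrier := borel S.carrier
instance (S : GSystem G) : BorelSpace S.carrier := ⟨rfl⟩

/-- A factor map between `G`-systems: a continuous equivariant surjection. -/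
structure FactorMap (S T : GSystem G) where
  toFun : S.carrier → T.carrier
  cont : Continuous toFun
  surj : Function.Surjective toFun
  equiv : ∀ g x, toFun (S.act g x) = T.act g (toFun x)

/-- The dynamical (Bowen) metric `d_F(x,y) = max_{g∈F} d(gx,gy)`. -/
noncomputable def dynDist (S : GSystem G) (F : Finset G) (x y : S.carrier) : ℝ :=
  ((F.sup fun g => nndist (S.act g x) (S.act g y) : ℝ≥0) : ℝ)

/-- `diam(U, d_F) < ε`. -/
def diamLT (S : GSystem G) (F : Finset G) (U : Set S.carrier) (ε : ℝ) : Prop :=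
  ∀ x ∈ U, ∀ y ∈ U, dynDist S F x y < ε

/-- The Birkhoff-type sum `S_F f(x) = Σ_{g∈F} f(gx)`. -/
noncomputable def birk (S : GSystem G) (f : S.carrier → ℝ) (F : Finset G) (x : S.carrier) : ℝ :=
  ∑ g ∈ F, f (S.act g x)

variable (X : ℕ → GSystem G) (π : ∀ i, FactorMap (X i) (X (i + 1)))

/-- The recursively defined weighted quantities `P^a_{i+1}(Ω, f, F, ε)` (0-indexed: `wP … i`
corresponds to the paper's `P^a_{i+1}`, and `a i` to the paper's `a_{i+1}`). -/
noncomputable def wP (a : ℕ → ℝ) (f : (X 0).carrier → ℝ) (F : Finset G) (ε : ℝ) :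
    (i : ℕ) → Set (X i).carrier → ℝ
  | 0, Ω => sInf {s | ∃ (n : ℕ) (U : Fin n → Set (X 0).carrier),
      (∀ j, IsOpen (U j)) ∧ (Ω ⊆ ⋃ j, U j) ∧ (∀ j, diamLT (X 0) F (U j) ε) ∧
      s = ∑ j, Real.exp (sSup (birk (X 0) f F '' U j))}
  | i + 1, Ω => sInf {s | ∃ (n : ℕ) (U : Fin n → Set (X (i + 1)).carrier),
      (∀ j, IsOpen (U j)) ∧ (Ω ⊆ ⋃ j, U j) ∧ (∀ j, diamLT (X (i + 1)) F (U j) ε) ∧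
      s = ∑ j, (wP a f F ε i ((π i).toFun ⁻¹' U j)) ^ (a i)}

/-- `lim_n log P^a_r(X_r, f, F_n, ε) / |F_n|` (realized as a `limsup` in `EReal`; by the
Ornstein–Weiss lemma the limit exists, so this is the limit). -/
noncomputable def pressEps (r : ℕ) (a : ℕ → ℝ) (f : (X 0).carrier → ℝ)
    (Fn : ℕ → Finset G) (ε : ℝ) : EReal :=
  limsup (fun n =>
    ((Real.log (wP X π a f (Fn n) ε (r - 1) Set.univ) / ((Fn n).card : ℝ) : ℝ) : EReal)) atTop

/-- The `a`-weighted topological pressure `P^a(f,G) = lim_{ε→0} P^a(X_r,f,ε)`; since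
`P^a(X_r,f,ε)` is non-decreasing as `ε` decreases, the limit equals the supremum over `ε > 0`. -/
noncomputable def press (r : ℕ) (a : ℕ → ℝ) (f : (X 0).carrier → ℝ)
    (Fn : ℕ → Finset G) : EReal :=
  ⨆ (ε : ℝ) (_ : 0 < ε), pressEps X π r a f Fn ε

/-- Entropy `H_μ(p)` of a countable partition given by the fibers of `p`. -/
noncomputable def Hpart {Y : Type} [MeasurableSpace Y] {ι : Type}
    (μ : MeasureTheory.Measure Y) (p : Y → ι) : ℝ :=
  ∑' i : ι, Real.negMulLog ((μ (p ⁻¹' {i})).toReal)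

/-- `h_μ(p, G) = lim_n H_μ(p_{F_n})/|F_n|` (realized as a `limsup`, which equals the limit
since the limit exists). -/
noncomputable def hSeq (S : GSystem G) (Fn : ℕ → Finset G)
    (μ : MeasureTheory.Measure S.carrier) (p : S.carrier → ℕ) : ℝ :=
  limsup (fun n =>
    Hpart μ (fun x => fun g : (Fn n : Finset G) => p (S.act (g : G) x)) / ((Fn n).card : ℝ)) atTop

/-- The measure-theoretic entropy `h_μ(X,G)`: supremum of `h_μ(α,G)` over all finite
measurable partitions (encoded as measurable maps to `ℕ` with finite range). -/
noncomputable def mEnt (S : GSystem G) (Fn : ℕ → Finset G)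
    (μ : MeasureTheory.Measure S.carrier) : EReal :=
  ⨆ p : {p : S.carrier → ℕ // Measurable p ∧ (Set.range p).Finite},
    ((hSeq S Fn μ p.1 : ℝ) : EReal)

/-- `μ ∈ M^G(X)`: a `G`-invariant Borel probability measure. -/
def IsInvProb (S : GSystem G) (μ : MeasureTheory.Measure S.carrier) : Prop :=
  MeasureTheory.IsProbabilityMeasure μ ∧ ∀ g : G, μ.map (S.act g) = μ

/-- `π^{(i)} = π_i ∘ ⋯ ∘ π_1 : X_1 → X_{i+1}` (0-indexed). -/
noncomputable def chainMap : (i : ℕ) → (X 0).carrier → (X i).carrier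
  | 0 => id
  | i + 1 => (π i).toFun ∘ chainMap i

/-- The weights `w_1 = a_1⋯a_{r−1}`, `w_i = (1−a_{i−1})a_i⋯a_{r−1}`, `w_r = 1−a_{r−1}`
(0-indexed: `wt a r i` is the paper's `w_{i+1}`, `a j` the paper's `a_{j+1}`). -/
noncomputable def wt (a : ℕ → ℝ) (r i : ℕ) : ℝ :=
  if i = 0 then ∏ j ∈ Finset.range (r - 1), a j
  else (1 - a (i - 1)) * ∏ j ∈ Finset.Ico i (r - 1), a j

/-- `Σ_{i=1}^r w_i h_{μ_i}(X_i,G) + w_1 ∫ f dμ`. -/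
noncomputable def wSum (r : ℕ) (a : ℕ → ℝ) (Fn : ℕ → Finset G) (f : (X 0).carrier → ℝ)
    (μ : MeasureTheory.Measure (X 0).carrier) : EReal :=
  (∑ i ∈ Finset.range r, ((wt a r i : ℝ) : EReal) * mEnt (X i) Fn (μ.map (chainMap X π i)))
    + (((wt a r 0) * ∫ x, f x ∂μ : ℝ) : EReal)

/-- `P^a_var(f,G) = sup_{μ ∈ M^G(X_1)} ( Σ w_i h_{μ_i}(X_i,G) + w_1 ∫ f dμ )`. -/
noncomputable def Pvar (r : ℕ) (a : ℕ → ℝ) (Fn : ℕ → Finset G)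
    (f : (X 0).carrier → ℝ) : EReal :=
  ⨆ μ : {μ : MeasureTheory.Measure (X 0).carrier // IsInvProb (X 0) μ},
    wSum X π r a Fn f μ.1

end WPP

namespace WPP

variable {G : Type} [Group G]

open Classical in
/-- A chain of open `(F,ε)`-covers `(𝒰^{(i)})_i` of `(X_i)_i` with assignment maps
`c i : U ∈ 𝒰^{(i+1)} ↦ 𝒰^{(i)}(U) ⊆ 𝒰^{(i)}` (Definition 2.10): every `𝒰^{(i)}` is an
open cover of `X_i` all of whose members have `d_F^{(i)}`-diameter `< ε`, for each
`U ∈ 𝒰^{(i+1)}` we have `π_i^{−1}(U) ⊆ ⋃ 𝒰^{(i)}(U)`, and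
`𝒰^{(i)} = ⋃_{U ∈ 𝒰^{(i+1)}} 𝒰^{(i)}(U)`. -/
def IsOpenChainCover (X : ℕ → GSystem G) (π : ∀ i, FactorMap (X i) (X (i + 1))) (r : ℕ)
    (F : Finset G) (ε : ℝ) (Us : ∀ i, Finset (Set (X i).carrier))
    (c : ∀ i, Set (X (i + 1)).carrier → Finset (Set (X i).carrier)) : Prop :=
  (∀ i < r, ∀ A ∈ Us i, IsOpen A) ∧
  (∀ i < r, ⋃₀ (Us i : Set (Set (X i).carrier)) = Set.univ) ∧
  (∀ i < r, ∀ A ∈ Us i, diamLT (X i) F A ε) ∧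
  (∀ i, i + 1 < r → ∀ A ∈ Us (i + 1),
      c i A ⊆ Us i ∧ (π i).toFun ⁻¹' A ⊆ ⋃₀ (c i A : Set (Set (X i).carrier))) ∧
  (∀ i, i + 1 < r → Us i = (Us (i + 1)).biUnion (c i))

/-- The iterated value attached to a member `A` of `𝒰^{(i+1)}` in the nested sum
`𝒫^a(f,F,ε,(𝒰^{(i)})_i)`:  `chainVal 0 A = e^{sup_A S_F f}` and
`chainVal (i+1) A = (Σ_{B ∈ 𝒰^{(i+1)}(A)} chainVal i B)^{a_{i+1}}`. -/
noncomputable def chainVal (X : ℕ → GSystem G) (a : ℕ → ℝ) (f : (X 0).carrier → ℝ)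
    (F : Finset G) (c : ∀ i, Set (X (i + 1)).carrier → Finset (Set (X i).carrier)) :
    (i : ℕ) → Set (X i).carrier → ℝ
  | 0, A => Real.exp (sSup (birk (X 0) f F '' A))
  | i + 1, A => (∑ B ∈ c i A, chainVal X a f F c i B) ^ (a i)

end WPP

namespace WPP

variable {G : Type} [Group G]

theorem continuous_dynDist (S : GSystem G) (F : Finset G) (x : S.carrier) :
    Continuous (dynDist S F x) := by
  refine NNReal.continuous_coe.comp (Continuous.finset_sup_apply fun g _ =>
    continuous_const.nndist (S.cont_act g))

theorem dynDist_self (S : GSystem G) (F : Finset G) (x : S.carrier) : dynDist S F x x = 0 := by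
  simp [dynDist]

theorem dynDist_le_add (S : GSystem G) (F : Finset G) (x y z : S.carrier) :
    dynDist S F y z ≤ dynDist S F x y + dynDist S F x z := by
  unfold dynDist
  rw [← NNReal.coe_add, NNReal.coe_le_coe]
  refine Finset.sup_le fun g hg => (nndist_triangle_left _ _ (S.act g x)).trans ?_
  exact add_le_add (Finset.le_sup (f := fun g => nndist (S.act g x) (S.act g y)) hg)
    (Finset.le_sup (f := fun g => nndist (S.act g x) (S.act g z)) hg)

theorem exists_finite_open_cover (S : GSystem G) (F : Finset G) {ε : ℝ} (hε : 0 < ε) :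
    ∃ (n : ℕ) (U : Fin n → Set S.carrier),
      (∀ j, IsOpen (U j)) ∧ Set.univ ⊆ ⋃ j, U j ∧ ∀ j, diamLT S F (U j) ε := by
  obtain ⟨t, ht⟩ := (isCompact_univ (X := S.carrier)).elim_finite_subcover
    (fun x => {y | dynDist S F x y < ε / 2})
    (fun x => isOpen_lt (continuous_dynDist S F x) continuous_const)
    (fun x _ => Set.mem_iUnion.2 ⟨x, by simpa [dynDist_self] using hε⟩)
  refine ⟨t.card, fun j => {y | dynDist S F (t.equivFin.symm j) y < ε / 2},
    fun j => isOpen_lt (continuous_dynDist S F _) continuous_const, fun y hy => ?_,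
    fun j y hy z hz => ?_⟩
  · obtain ⟨x, hx, hxy⟩ := Set.mem_iUnion₂.1 (ht hy)
    exact Set.mem_iUnion.2 ⟨t.equivFin ⟨x, hx⟩, by simpa using hxy⟩
  · have := dynDist_le_add S F (t.equivFin.symm j) y z
    simp only [Set.mem_ofPred_eq] at hy hz
    linarith

/-- The summand attached to a member `A` of a cover of `X i` in the infimum defining `wP … i`. -/
noncomputable def coverVal (X : ℕ → GSystem G) (π : ∀ i, FactorMap (X i) (X (i + 1)))
    (a : ℕ → ℝ) (f : (X 0).carrier → ℝ) (F : Finset G) (ε : ℝ) :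
    (i : ℕ) → Set (X i).carrier → ℝ
  | 0, A => Real.exp (sSup (birk (X 0) f F '' A))
  | i + 1, A => (wP X π a f F ε i ((π i).toFun ⁻¹' A)) ^ (a i)

/-- The members of `V` are open sets of `d_F`-diameter less than `ε`. -/
def IsSmallOpen (S : GSystem G) (F : Finset G) (ε : ℝ) (V : Finset (Set S.carrier)) : Prop :=
  ∀ A ∈ V, IsOpen A ∧ diamLT S F A ε

variable {X : ℕ → GSystem G} {π : ∀ i, FactorMap (X i) (X (i + 1))} {a : ℕ → ℝ}
  {f : (X 0).carrier → ℝ} {F : Finset G} {ε : ℝ}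

theorem wP_eq_sInf_coverVal (i : ℕ) (Ω : Set (X i).carrier) :
    wP X π a f F ε i Ω = sInf {s | ∃ (n : ℕ) (U : Fin n → Set (X i).carrier),
      (∀ j, IsOpen (U j)) ∧ (Ω ⊆ ⋃ j, U j) ∧ (∀ j, diamLT (X i) F (U j) ε) ∧
      s = ∑ j, coverVal X π a f F ε i (U j)} := by
  cases i <;> rfl

theorem coverVal_nonneg (i : ℕ) (A : Set (X i).carrier) : 0 ≤ coverVal X π a f F ε i A := by
  induction i with
  | zero => exact (Real.exp_pos _).le
  | succ i ih =>
    refine Real.rpow_nonneg ?_ _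
    rw [wP_eq_sInf_coverVal]
    refine Real.sInf_nonneg ?_
    rintro s ⟨n, U, -, -, -, rfl⟩
    exact Finset.sum_nonneg fun j _ => ih _

theorem wP_nonneg (i : ℕ) (Ω : Set (X i).carrier) : 0 ≤ wP X π a f F ε i Ω := by
  rw [wP_eq_sInf_coverVal]
  refine Real.sInf_nonneg ?_
  rintro s ⟨n, U, -, -, -, rfl⟩
  exact Finset.sum_nonneg fun j _ => coverVal_nonneg _ _

theorem chainVal_nonneg (c : ∀ i, Set (X (i + 1)).carrier → Finset (Set (X i).carrier)) (i : ℕ)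
    (A : Set (X i).carrier) : 0 ≤ chainVal X a f F c i A := by
  induction i with
  | zero => exact (Real.exp_pos _).le
  | succ i ih => exact Real.rpow_nonneg (Finset.sum_nonneg fun B _ => ih B) _

theorem chainVal_congr {c c' : ∀ i, Set (X (i + 1)).carrier → Finset (Set (X i).carrier)} {i : ℕ}
    (h : ∀ j < i, c j = c' j) (A : Set (X i).carrier) :
    chainVal X a f F c i A = chainVal X a f F c' i A := by
  induction i with
  | zero => rfl
  | succ i ih =>
    simp only [chainVal, h i i.lt_succ_self]
    exact congrArg (· ^ a i)
      (Finset.sum_congr rfl fun B _ => ih (fun j hj => h j (hj.trans i.lt_succ_self)) B)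

theorem wP_le_sum_coverVal {i : ℕ} {Ω : Set (X i).carrier} {V : Finset (Set (X i).carrier)}
    (hV : IsSmallOpen (X i) F ε V) (hΩ : Ω ⊆ ⋃₀ (V : Set (Set (X i).carrier))) :
    wP X π a f F ε i Ω ≤ ∑ A ∈ V, coverVal X π a f F ε i A := by
  rw [wP_eq_sInf_coverVal]
  refine csInf_le ⟨0, ?_⟩
    ⟨V.card, fun j => V.equivFin.symm j, fun j => (hV _ (V.equivFin.symm j).2).1, ?_,
      fun j => (hV _ (V.equivFin.symm j).2).2, ?_⟩
  · rintro s ⟨n, U, -, -, -, rfl⟩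
    exact Finset.sum_nonneg fun j _ => coverVal_nonneg _ _
  · intro x hx
    obtain ⟨A, hA, hxA⟩ := hΩ hx
    exact Set.mem_iUnion.2 ⟨V.equivFin ⟨A, hA⟩, by simpa using hxA⟩
  · rw [← Finset.sum_coe_sort V]
    exact (Equiv.sum_comp V.equivFin.symm fun A : V => coverVal X π a f F ε i A).symm

theorem exists_cover_sum_coverVal_lt (hε : 0 < ε) {i : ℕ} {Ω : Set (X i).carrier} {t : ℝ}
    (ht : wP X π a f F ε i Ω < t) :
    ∃ V : Finset (Set (X i).carrier), IsSmallOpen (X i) F ε V ∧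
      Ω ⊆ ⋃₀ (V : Set (Set (X i).carrier)) ∧ ∑ A ∈ V, coverVal X π a f F ε i A < t := by
  classical
  rw [wP_eq_sInf_coverVal] at ht
  obtain ⟨s, ⟨n, U, hopen, hcov, hdiam, rfl⟩, hs⟩ := exists_lt_of_csInf_lt (by
    obtain ⟨n, U, hopen, hcov, hdiam⟩ := exists_finite_open_cover (X i) F hε
    exact ⟨_, n, U, hopen, (Set.subset_univ _).trans hcov, hdiam, rfl⟩) ht
  refine ⟨Finset.univ.image U, ?_, ?_, lt_of_le_of_lt ?_ hs⟩
  · intro A hA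
    obtain ⟨j, -, rfl⟩ := Finset.mem_image.1 hA
    exact ⟨hopen j, hdiam j⟩
  · simpa [Set.sUnion_range] using hcov
  · exact Finset.sum_image_le_of_nonneg fun _ _ => coverVal_nonneg _ _

theorem coverVal_le_chainVal {r : ℕ} (ha : ∀ i, i + 1 < r → 0 ≤ a i)
    {Us : ∀ i, Finset (Set (X i).carrier)}
    {c : ∀ i, Set (X (i + 1)).carrier → Finset (Set (X i).carrier)}
    (h : IsOpenChainCover X π r F ε Us c) {i : ℕ} (hi : i < r) {A : Set (X i).carrier}
    (hA : A ∈ Us i) : coverVal X π a f F ε i A ≤ chainVal X a f F c i A := by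
  obtain ⟨hopen, -, hdiam, hc, -⟩ := h
  induction i with
  | zero => exact le_rfl
  | succ i ih =>
    obtain ⟨hsub, hcov⟩ := hc i hi A hA
    have hi' : i < r := by omega
    refine Real.rpow_le_rpow (wP_nonneg _ _) ?_ (ha i hi)
    exact (wP_le_sum_coverVal (fun B hB => ⟨hopen i hi' B (hsub hB), hdiam i hi' B (hsub hB)⟩)
      hcov).trans (Finset.sum_le_sum fun B hB => ih hi' (hsub hB))

theorem exists_gt_rpow_lt {x q s : ℝ} (hq : 0 ≤ q) (h : x ^ q < s) : ∃ t, x < t ∧ t ^ q < s := by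
  have hev : ∀ᶠ t in nhdsWithin x (Set.Ioi x), t ^ q < s :=
    ((Real.continuousAt_rpow_const x q (Or.inr hq)).eventually_lt_const h).filter_mono
      nhdsWithin_le_nhds
  obtain ⟨t, ht, hxt⟩ := (hev.and self_mem_nhdsWithin).exists
  exact ⟨t, hxt, ht⟩

theorem exists_pos_forall_sum_add_lt {α β : Type*} (V : Finset α) (W : α → Finset β) (v : β → ℝ)
    (t : α → ℝ) (h : ∀ A ∈ V, ∑ B ∈ W A, v B < t A) :
    ∃ η > 0, ∀ A ∈ V, ∑ B ∈ W A, (v B + η) < t A := by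
  have hev : ∀ᶠ η in nhdsWithin (0 : ℝ) (Set.Ioi 0), ∀ A ∈ V, ∑ B ∈ W A, (v B + η) < t A := by
    refine ((Filter.eventually_all_finset V).2 fun A hA => ?_).filter_mono nhdsWithin_le_nhds
    have hcont : Continuous fun η : ℝ => ∑ B ∈ W A, (v B + η) := by fun_prop
    exact hcont.continuousAt.eventually_lt_const (by simpa using h A hA)
  obtain ⟨η, hη, hpos⟩ := (hev.and self_mem_nhdsWithin).exists
  exact ⟨η, hpos, hη⟩

open Classical in
theorem IsOpenChainCover.extend {n : ℕ} {Us : ∀ i, Finset (Set (X i).carrier)}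
    {c : ∀ i, Set (X (i + 1)).carrier → Finset (Set (X i).carrier)}
    (h : IsOpenChainCover X π (n + 1) F ε Us c) {V : Finset (Set (X (n + 1)).carrier)}
    {W : Set (X (n + 1)).carrier → Finset (Set (X n).carrier)}
    (hV : IsSmallOpen (X (n + 1)) F ε V)
    (hcov : ⋃₀ (V : Set (Set (X (n + 1)).carrier)) = Set.univ)
    (hW : ∀ A ∈ V, (π n).toFun ⁻¹' A ⊆ ⋃₀ (W A : Set (Set (X n).carrier)))
    (hUs : Us n = V.biUnion W) :
    IsOpenChainCover X π (n + 2) F ε (Function.update Us (n + 1) V) (Function.update c n W) := by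
  obtain ⟨h1, h2, h3, h4, h5⟩ := h
  refine ⟨fun i hi => ?_, fun i hi => ?_, fun i hi => ?_, fun i hi => ?_, fun i hi => ?_⟩
  · obtain hi | rfl := Nat.lt_succ_iff_lt_or_eq.1 hi
    · simpa [hi.ne] using h1 i hi
    · simpa using fun A hA => (hV A hA).1
  · obtain hi | rfl := Nat.lt_succ_iff_lt_or_eq.1 hi
    · simpa [hi.ne] using h2 i hi
    · simpa using hcov
  · obtain hi | rfl := Nat.lt_succ_iff_lt_or_eq.1 hi
    · simpa [hi.ne] using h3 i hi
    · simpa using fun A hA => (hV A hA).2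
  · obtain hi | rfl := Nat.lt_succ_iff_lt_or_eq.1 (Nat.lt_of_succ_lt_succ hi)
    · simpa [hi.ne, (hi.trans n.lt_succ_self).ne] using h4 i (Nat.succ_lt_succ hi)
    · simp only [Function.update_self, Function.update_of_ne i.lt_succ_self.ne, hUs]
      exact fun A hA => ⟨Finset.subset_biUnion_of_mem W hA, hW A hA⟩
  · obtain hi | rfl := Nat.lt_succ_iff_lt_or_eq.1 (Nat.lt_of_succ_lt_succ hi)
    · simpa [hi.ne, (hi.trans n.lt_succ_self).ne] using h5 i (Nat.succ_lt_succ hi)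
    · simpa using hUs

theorem exists_isOpenChainCover_chainVal_lt (hε : 0 < ε) (n : ℕ) (ha : ∀ i < n, 0 ≤ a i)
    {V : Finset (Set (X n).carrier)} (hV : IsSmallOpen (X n) F ε V)
    (hcov : ⋃₀ (V : Set (Set (X n).carrier)) = Set.univ) {u : Set (X n).carrier → ℝ}
    (hu : ∀ A ∈ V, coverVal X π a f F ε n A < u A) :
    ∃ (Us : ∀ i, Finset (Set (X i).carrier))
      (c : ∀ i, Set (X (i + 1)).carrier → Finset (Set (X i).carrier)),
      IsOpenChainCover X π (n + 1) F ε Us c ∧ Us n = V ∧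
      ∀ A ∈ V, chainVal X a f F c n A < u A := by
  classical
  induction n with
  | zero =>
    refine ⟨Function.update (fun _ => ∅) 0 V, fun _ _ => ∅, ⟨?_, ?_, ?_, ?_, ?_⟩, by simp, hu⟩
    · intro i hi
      obtain rfl : i = 0 := by omega
      simpa using fun A hA => (hV A hA).1
    · intro i hi
      obtain rfl : i = 0 := by omega
      simpa using hcov
    · intro i hi
      obtain rfl : i = 0 := by omega
      simpa using fun A hA => (hV A hA).2
    · intro i hi
      omega
    · intro i hi
      omega
  | succ n ih =>
    have key : ∀ A ∈ V, ∃ (t : ℝ) (W : Finset (Set (X n).carrier)),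
        t ^ a n < u A ∧ IsSmallOpen (X n) F ε W ∧
        (π n).toFun ⁻¹' A ⊆ ⋃₀ (W : Set (Set (X n).carrier)) ∧
        ∑ B ∈ W, coverVal X π a f F ε n B < t := by
      intro A hA
      obtain ⟨t, ht, htu⟩ := exists_gt_rpow_lt (ha n n.lt_succ_self) (hu A hA)
      obtain ⟨W, hW⟩ := exists_cover_sum_coverVal_lt hε ht
      exact ⟨t, W, htu, hW⟩
    choose! t W htu hWsmall hWcov hWt using key
    obtain ⟨η, hη, hηt⟩ := exists_pos_forall_sum_add_lt V W _ t hWt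
    obtain ⟨Us, c, hchain, hUs, hlt⟩ := ih (fun i hi => ha i (hi.trans n.lt_succ_self))
      (V := V.biUnion W) (u := fun B => coverVal X π a f F ε n B + η)
      (fun B hB => by
        obtain ⟨A, hA, hBA⟩ := Finset.mem_biUnion.1 hB
        exact hWsmall A hA B hBA)
      (Set.eq_univ_of_forall fun x => by
        obtain ⟨A, hA, hxA⟩ := Set.mem_sUnion.1 (hcov.ge (Set.mem_univ ((π n).toFun x)))
        obtain ⟨B, hB, hxB⟩ := hWcov A hA hxA
        exact ⟨B, Finset.mem_biUnion.2 ⟨A, hA, hB⟩, hxB⟩)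
      (fun B _ => lt_add_of_pos_right _ hη)
    refine ⟨_, _, hchain.extend hV hcov hWcov (hUs.trans (by congr)), by simp, fun A hA => ?_⟩
    refine lt_of_le_of_lt ?_ (htu A hA)
    simp only [chainVal, Function.update_self]
    refine Real.rpow_le_rpow (Finset.sum_nonneg fun B _ => chainVal_nonneg _ _ _) ?_
      (ha n n.lt_succ_self)
    refine (Finset.sum_le_sum fun B hB => ?_).trans (hηt A hA).le
    rw [chainVal_congr (c' := c) fun j hj => Function.update_of_ne hj.ne _ _]
    exact (hlt B (Finset.mem_biUnion.2 ⟨A, hA, hB⟩)).le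

theorem exists_isOpenChainCover_sum_lt (hε : 0 < ε) (n : ℕ) (ha : ∀ i < n, 0 ≤ a i) {t : ℝ}
    (ht : wP X π a f F ε n Set.univ < t) :
    ∃ (Us : ∀ i, Finset (Set (X i).carrier))
      (c : ∀ i, Set (X (i + 1)).carrier → Finset (Set (X i).carrier)),
      IsOpenChainCover X π (n + 1) F ε Us c ∧ ∑ A ∈ Us n, chainVal X a f F c n A < t := by
  obtain ⟨V, hV, hcov, hVt⟩ := exists_cover_sum_coverVal_lt hε ht
  obtain ⟨η, hη, hηt⟩ := exists_pos_forall_sum_add_lt {()} (fun _ => V) _ (fun _ => t)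
    fun _ _ => hVt
  obtain ⟨Us, c, hchain, rfl, hlt⟩ := exists_isOpenChainCover_chainVal_lt hε n ha hV
    (Set.univ_subset_iff.1 hcov) fun _ _ => lt_add_of_pos_right _ hη
  exact ⟨Us, c, hchain, (Finset.sum_le_sum fun A hA => (hlt A hA).le).trans_lt
    (hηt () (Finset.mem_singleton_self _))⟩

end WPP

open WPP in
/-- Remark 2.11 (chain-of-covers characterization): for every `f ∈ C(X_1)`, every nonempty
finite `F ⊆ G` and every `ε > 0`, `P^a_r(X_r,f,F,ε)` equals the infimum of
`𝒫^a(f,F,ε,(𝒰^{(i)})_i)` over all chains of open `(F,ε)`-covers `(𝒰^{(i)})_i` of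
`(X_i)_i`, where `𝒫^a(f,F,ε,(𝒰^{(i)})_i)` is the nested weighted sum
`Σ_{U^{(r)}∈𝒰^{(r)}} (Σ_{U^{(r−1)}∈𝒰^{(r−1)}(U^{(r)})} (⋯ (Σ_{U^{(1)}∈𝒰^{(1)}(U^{(2)})}
e^{sup_{U^{(1)}} S_F f})^{a_1} ⋯)^{a_{r−2}})^{a_{r−1}}`. -/
theorem wP_eq_inf_over_chains
    {G : Type} [Group G] [Countable G] [Infinite G]
    (X : ℕ → GSystem G) (π : ∀ i, FactorMap (X i) (X (i + 1)))
    (r : ℕ) (hr : 2 ≤ r) (a : ℕ → ℝ) (ha : ∀ i < r - 1, a i ∈ Set.Icc (0 : ℝ) 1)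
    (f : (X 0).carrier → ℝ) (hf : Continuous f)
    (F : Finset G) (hF : F.Nonempty) (ε : ℝ) (hε : 0 < ε) :
    wP X π a f F ε (r - 1) Set.univ =
      sInf {s | ∃ (Us : ∀ i, Finset (Set (X i).carrier))
          (c : ∀ i, Set (X (i + 1)).carrier → Finset (Set (X i).carrier)),
          IsOpenChainCover X π r F ε Us c ∧
          s = ∑ A ∈ Us (r - 1), chainVal X a f F c (r - 1) A} := by
  obtain ⟨n, rfl⟩ : ∃ n, r = n + 1 := ⟨r - 1, by omega⟩
  simp only [Nat.add_sub_cancel] at ha ⊢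
  have ha0 : ∀ i < n, 0 ≤ a i := fun i hi => (ha i hi).1
  apply le_antisymm
  · refine le_csInf ?_ ?_
    · obtain ⟨Us, c, h, -⟩ := exists_isOpenChainCover_sum_lt (π := π) (f := f) (F := F) hε n ha0
        (lt_add_one _)
      exact ⟨_, Us, c, h, rfl⟩
    · rintro s ⟨Us, c, h, rfl⟩
      refine (wP_le_sum_coverVal (fun A hA => ⟨h.1 n n.lt_succ_self A hA,
        h.2.2.1 n n.lt_succ_self A hA⟩) (h.2.1 n n.lt_succ_self).ge).trans ?_
      exact Finset.sum_le_sum fun A hA =>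
        coverVal_le_chainVal (fun i hi => ha0 i (by omega)) h n.lt_succ_self hA
  · refine le_of_forall_gt_imp_ge_of_dense fun t ht => ?_
    obtain ⟨Us, c, h, hlt⟩ := exists_isOpenChainCover_sum_lt hε n ha0 ht
    refine le_trans (csInf_le ⟨0, ?_⟩ ⟨Us, c, h, rfl⟩) hlt.le
    rintro s ⟨Us, c, -, rfl⟩
    exact Finset.sum_nonneg fun A _ => chainVal_nonneg _ _ _
end
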